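/- Let C be a binary linear code of length 23 and dimension 12 over F_2 that is perfect with radius 3 (i.e., every vector of F_2^23 lies at Hamming distance at most 3 from exactly one codeword of C), and let S : F_2^23 → F_2^{11-r} × F_2^r be a surjective linear map whose kernel is C, for some 0 ≤ r ≤ 11. If ℓ ≤ 23 and 6·(2^r - 1) ≥ 1592·ℓ - 69·ℓ² + ℓ³, then for every x ∈ F_2^23, every message m ∈ F_2^{11-r}, and every set I ⊆ {1,…,23} with |I| = ℓ, there exist y ∈ F_2^23 and R ∈ F_2^r such that S(y) = (m, R), d(x,y) ≤ 3, and y_i = x_i for all i ∈ I. -/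

import Mathlib

open Finset

/-- A linear map whose kernel has unique decoding within radius `ρ` is injective on every Hamming
ball of radius `ρ`. -/
lemma injOn_hammingBall_of_unique_decoding {ι K W : Type*} [Fintype ι] [Field K] [DecidableEq K]
    [AddCommGroup W] [Module K W] {ρ : ℕ} (S : (ι → K) →ₗ[K] W)
    (hdec : ∀ v : ι → K, ∃! c, c ∈ LinearMap.ker S ∧ hammingDist v c ≤ ρ) (x : ι → K) :
    Set.InjOn S {y | hammingDist x y ≤ ρ} := by
  intro y hy z hz hyz
  have hzero : (0 : ι → K) ∈ LinearMap.ker S ∧ hammingDist (y - x) 0 ≤ ρ := by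
    refine ⟨zero_mem _, ?_⟩
    rw [hammingDist_zero_right, sub_eq_neg_add, ← hammingDist_eq_hammingNorm]
    exact hy
  have hsub : y - z ∈ LinearMap.ker S ∧ hammingDist (y - x) (y - z) ≤ ρ := by
    refine ⟨by simp [hyz], ?_⟩
    rw [hammingDist_eq_hammingNorm, show -(y - x) + (y - z) = -z + x by abel,
      ← hammingDist_eq_hammingNorm, hammingDist_comm]
    exact hz
  exact sub_eq_zero.mp ((hdec (y - x)).unique hsub hzero)

/-- The number of subsets of `s` with at most `ρ` elements. -/
lemma card_filter_powerset_card_le {α : Type*} [DecidableEq α] (s : Finset α) (ρ : ℕ) :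
    #{T ∈ s.powerset | #T ≤ ρ} = ∑ i ∈ range (ρ + 1), (#s).choose i := by
  have hmaps : ∀ T ∈ s.powerset.filter (#· ≤ ρ), #T ∈ range (ρ + 1) := by
    intro T hT
    simpa [Nat.lt_succ_iff] using (mem_filter.mp hT).2
  rw [card_eq_sum_card_fiberwise hmaps]
  refine sum_congr rfl fun i hi => ?_
  rw [← card_powersetCard]
  congr 1
  ext T
  have := mem_range.mp hi
  simp only [mem_filter, mem_powerset, mem_powersetCard]
  grind

/-- A Hamming ball with the coordinates in `I` locked contains at least as many points as there are
small sets of flipped coordinates outside `I`. -/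
lemma sum_choose_le_card_locked_hammingBall {ι K : Type*} [Fintype ι] [DecidableEq ι] [Field K]
    [Fintype K] [DecidableEq K] (x : ι → K) (I : Finset ι) (ρ : ℕ) :
    ∑ i ∈ range (ρ + 1), (Fintype.card ι - #I).choose i ≤
      #{y : ι → K | hammingDist x y ≤ ρ ∧ ∀ i ∈ I, y i = x i} := by
  rw [← card_compl, ← card_filter_powerset_card_le]
  have hdiff (T : Finset ι) (i : ι) : x i ≠ x i + (if i ∈ T then 1 else 0) ↔ i ∈ T := by
    split_ifs with h <;> simp [h]
  refine card_le_card_of_injOn (fun T i => x i + if i ∈ T then 1 else 0) ?_ ?_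
  · intro T hT
    obtain ⟨hTI, hTρ⟩ := mem_filter.mp hT
    refine mem_filter.mpr ⟨mem_univ _, ?_, fun i hi => ?_⟩
    · simpa only [hammingDist, hdiff, filter_univ_mem] using hTρ
    · have : i ∉ T := fun h => mem_compl.mp (mem_powerset.mp hTI h) hi
      simp [this]
  · intro T _ U _ hTU
    ext i
    rw [← hdiff T i, ← hdiff U i]
    exact iff_of_eq (congrArg (x i ≠ ·) (congrFun hTU i))

/-- Randomized wet paper syndrome coding is solvable as soon as the fiber of `m` and the locked
Hamming ball together outnumber the syndromes. -/
lemma exists_locked_of_card_lt {ι K M N : Type*} [Fintype ι] [DecidableEq ι] [Field K] [Fintype K]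
    [DecidableEq K] [AddCommGroup M] [Module K M] [Fintype M] [AddCommGroup N] [Module K N]
    [Fintype N] {ρ : ℕ} (S : (ι → K) →ₗ[K] M × N)
    (hdec : ∀ v : ι → K, ∃! c, c ∈ LinearMap.ker S ∧ hammingDist v c ≤ ρ)
    (x : ι → K) (m : M) (I : Finset ι)
    (hcard : Fintype.card (M × N) <
      Fintype.card N + ∑ i ∈ range (ρ + 1), (Fintype.card ι - #I).choose i) :
    ∃ (y : ι → K) (R : N), S y = (m, R) ∧ hammingDist x y ≤ ρ ∧ ∀ i ∈ I, y i = x i := by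
  have hball := sum_choose_le_card_locked_hammingBall x I ρ
  set A : Finset (ι → K) := {y | hammingDist x y ≤ ρ ∧ ∀ i ∈ I, y i = x i}
  classical
  have hinj : Set.InjOn S A :=
    (injOn_hammingBall_of_unique_decoding S hdec x).mono fun y hy => (mem_filter.mp hy).2.1
  have hfiber : #(univ.map (.sectR m N)) = Fintype.card N := by rw [card_map, card_univ]
  by_contra! hnone
  have hdisj : Disjoint (univ.map (.sectR m N)) (A.image S) := by
    refine disjoint_left.mpr fun s hs hsA => ?_
    obtain ⟨R, -, rfl⟩ := mem_map.mp hs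
    obtain ⟨y, hy, hyR⟩ := mem_image.mp hsA
    obtain ⟨-, hxy, hlock⟩ := mem_filter.mp hy
    obtain ⟨i, hi, hne⟩ := hnone y R hyR hxy
    exact hne (hlock i hi)
  have hle := card_le_univ ((univ.map (.sectR m N)).disjUnion (A.image S) hdisj)
  rw [card_disjUnion, hfiber, card_image_of_injOn hinj] at hle
  omega

/-- For the binary `[23,12]` Golay code (perfect with radius 3), if
`6·(2^r - 1) ≥ 1592ℓ - 69ℓ² + ℓ³` (and `ℓ ≤ 23`), the randomized wet paper syndrome coding
problem always has a solution for any `ℓ` locked coordinates. -/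
theorem randomized_wet_paper_binary_golay
    (r ℓ : ℕ) (hr : r ≤ 11)
    (C : Submodule (ZMod 2) (Fin 23 → ZMod 2))
    (hk : Module.finrank (ZMod 2) C = 12)
    (hperf : ∀ v : Fin 23 → ZMod 2, ∃! c, c ∈ C ∧ hammingDist v c ≤ 3)
    (S : (Fin 23 → ZMod 2) →ₗ[ZMod 2] (Fin (11 - r) → ZMod 2) × (Fin r → ZMod 2))
    (hS_surj : Function.Surjective S)
    (hS_ker : LinearMap.ker S = C)
    (hℓ : ℓ ≤ 23)
    (hineq : (1592 * ℓ - 69 * ℓ ^ 2 + ℓ ^ 3 : ℤ) ≤ 6 * (2 ^ r - 1)) :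
    ∀ (x : Fin 23 → ZMod 2) (m : Fin (11 - r) → ZMod 2) (I : Finset (Fin 23)), I.card = ℓ →
      ∃ (y : Fin 23 → ZMod 2) (R : Fin r → ZMod 2),
        S y = (m, R) ∧ hammingDist x y ≤ 3 ∧ ∀ i ∈ I, y i = x i := by
  intro x m I hI
  subst hS_ker
  refine exists_locked_of_card_lt S hperf x m I ?_
  have hcard : Fintype.card ((Fin (11 - r) → ZMod 2) × (Fin r → ZMod 2)) = 2048 := by
    simp only [Fintype.card_prod, Fintype.card_fun, ZMod.card, Fintype.card_fin]
    rw [← pow_add, Nat.sub_add_cancel hr]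
    norm_num
  rw [hcard, hI]
  simp only [Fintype.card_fun, ZMod.card, Fintype.card_fin]
  zify
  interval_cases ℓ <;> norm_num [sum_range_succ, Nat.choose] at hineq ⊢ <;> linarith
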